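/- Let G be a connected, non-complete, claw-free finite simple graph, let P be a minimal non-complete dominating module of G (a non-complete dominating module of G that cannot be partitioned into two non-complete dominating modules of G), and let S ⊆ P be a set of vertices such that the induced subgraph G[S] is connected and not complete. Let c be a proper vertex colouring of G such that no colour appearing on a vertex of P appears on a vertex outside P, and such that every automorphism of G preserving c fixes every vertex of S. Then every automorphism of G preserving c fixes every vertex of P. -/

import Mathlib

open SimpleGraph

/-- A proper colouring `c` of `G` is distinguishing if the identity is the only
automorphism of `G` preserving `c`. -/
def SimpleGraph.IsDistinguishingColoring {V α : Type*} (G : SimpleGraph V)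
    (c : G.Coloring α) : Prop :=
  ∀ φ : G ≃g G, (∀ v, c (φ v) = c v) → ∀ v, φ v = v

/-- The distinguishing chromatic number of `G`: the least `k` such that `G` has a
proper vertex colouring with `k` colours preserved only by the identity automorphism. -/
noncomputable def SimpleGraph.distChromNum {V : Type*} (G : SimpleGraph V) : ℕ :=
  sInf {k | ∃ c : G.Coloring (Fin k), G.IsDistinguishingColoring c}

/-- The maximum degree of `G`, stated without decidability assumptions. -/
noncomputable def SimpleGraph.maxDeg {V : Type*} [Fintype V] (G : SimpleGraph V) : ℕ := by
  classical exact G.maxDegree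

/-- `G` contains no induced subgraph isomorphic to `H`. -/
def SimpleGraph.IsFreeOf {V W : Type*} (G : SimpleGraph V) (H : SimpleGraph W) : Prop :=
  ¬ Nonempty (H ↪g G)

/-- The claw `K_{1,3}`. -/
def clawGraph : SimpleGraph (Fin 1 ⊕ Fin 3) := completeBipartiteGraph (Fin 1) (Fin 3)

/-- `M` is a dominating set of `G`. -/
def SimpleGraph.IsDominatingSet {V : Type*} (G : SimpleGraph V) (M : Set V) : Prop :=
  ∀ v ∉ M, ∃ w ∈ M, G.Adj v w

/-- `M` is a module of `G`: every vertex outside `M` is complete or anti-complete to `M`. -/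
def SimpleGraph.IsModule {V : Type*} (G : SimpleGraph V) (M : Set V) : Prop :=
  ∀ v ∉ M, (∀ w ∈ M, G.Adj v w) ∨ (∀ w ∈ M, ¬ G.Adj v w)

/-- `M` is a non-complete dominating module of `G`. -/
def SimpleGraph.IsNCDModule {V : Type*} (G : SimpleGraph V) (M : Set V) : Prop :=
  ¬ G.IsClique M ∧ G.IsDominatingSet M ∧ G.IsModule M

theorem claw_aux {V : Type*} {G : SimpleGraph V} (hclaw : G.IsFreeOf clawGraph)
    {x a b d : V} (ha : G.Adj x a) (hb : G.Adj x b) (hd : G.Adj x d)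
    (hab : a ≠ b) (had : a ≠ d) (hbd : b ≠ d)
    (nab : ¬ G.Adj a b) (nad : ¬ G.Adj a d) (nbd : ¬ G.Adj b d) : False := by
  apply hclaw
  have nba : ¬ G.Adj b a := fun h => nab h.symm
  have nda : ¬ G.Adj d a := fun h => nad h.symm
  have ndb : ¬ G.Adj d b := fun h => nbd h.symm
  refine ⟨⟨⟨Sum.elim (fun _ => x) ![a, b, d], ?_⟩, ?_⟩⟩
  · rintro (i | i) (j | j) h
    · rw [Subsingleton.elim i j]
    · fin_cases j <;> simp at h
      · exact absurd h ha.ne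
      · exact absurd h hb.ne
      · exact absurd h hd.ne
    · fin_cases i <;> simp at h
      · exact absurd h ha.ne'
      · exact absurd h hb.ne'
      · exact absurd h hd.ne'
    · fin_cases i <;> fin_cases j <;> simp_all
  · intro p q
    change G.Adj (Sum.elim (fun _ => x) ![a, b, d] p) (Sum.elim (fun _ => x) ![a, b, d] q) ↔ _
    revert p q
    rintro (i | i) (j | j)
    · simp [clawGraph]
    · fin_cases j <;> simp [clawGraph, ha, hb, hd]
    · fin_cases i <;> simp [clawGraph, ha.symm, hb.symm, hd.symm]
    · fin_cases i <;> fin_cases j <;> simp [clawGraph, nab, nad, nbd, nba, nda, ndb]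

theorem statement_11 {V : Type*} [Fintype V] (G : SimpleGraph V)
    (hconn : G.Connected) (hnotcomplete : ¬ ∀ u v : V, u ≠ v → G.Adj u v)
    (hclaw : G.IsFreeOf clawGraph)
    (P : Set V) (hP : G.IsNCDModule P)
    (hPmin : ¬ ∃ P₁ P₂ : Set V, P₁ ∪ P₂ = P ∧ Disjoint P₁ P₂ ∧
      G.IsNCDModule P₁ ∧ G.IsNCDModule P₂)
    (S : Set V) (hSP : S ⊆ P)
    (hScon : (G.induce S).Connected) (hSnc : ¬ G.IsClique S)
    {α : Type*} (c : G.Coloring α)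
    (hsep : ∀ v ∈ P, ∀ w ∉ P, c w ≠ c v)
    (hfixS : ∀ φ : G ≃g G, (∀ v, c (φ v) = c v) → ∀ v ∈ S, φ v = v) :
    ∀ φ : G ≃g G, (∀ v, c (φ v) = c v) → ∀ v ∈ P, φ v = v := by
  intro φ hφ
  have hS := hfixS φ hφ
  obtain ⟨hPnc, hPdom, hPmod⟩ := hP
  -- vertices outside `P` are complete to `P`
  have hout : ∀ v ∉ P, ∀ w ∈ P, G.Adj v w := by
    intro v hv
    rcases hPmod v hv with h | h
    · exact h
    · obtain ⟨w, hw, hvw⟩ := hPdom v hv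
      exact absurd hvw (h w hw)
  have hφP : ∀ v ∈ P, φ v ∈ P := by
    intro v hv
    by_contra h
    exact hsep v hv _ h (hφ v)
  have hnadj : ∀ v, ¬ G.Adj v (φ v) := fun v h => c.valid h (hφ v).symm
  have hfadj : ∀ x v, φ x = x → (G.Adj x (φ v) ↔ G.Adj x v) := by
    intro x v hx
    conv_lhs => rw [← hx]
    exact φ.map_adj_iff
  -- nonadjacent pair in S
  obtain ⟨a, haS, b, hbS, hab, nab⟩ : ∃ a ∈ S, ∃ b ∈ S, a ≠ b ∧ ¬ G.Adj a b := by
    by_contra hcon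
    push Not at hcon
    exact hSnc fun a ha b hb hab => hcon a ha b hb hab
  -- the key claim
  suffices key : ∀ v ∈ P, φ v ≠ v → ∀ x ∈ P, φ x = x → G.Adj x v by
    by_contra hcon
    push Not at hcon
    obtain ⟨n, hnP, hn⟩ := hcon
    refine hPmin ⟨{v | v ∈ P ∧ φ v = v}, {v | v ∈ P ∧ φ v ≠ v}, ?_, ?_, ?_, ?_⟩
    · ext v
      simp only [Set.mem_union, Set.mem_ofPred_eq]
      tauto
    · rw [Set.disjoint_left]
      rintro v ⟨_, h⟩ ⟨_, h'⟩
      exact h' h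
    · have hall : ∀ v ∉ {v | v ∈ P ∧ φ v = v}, ∀ w ∈ {v | v ∈ P ∧ φ v = v}, G.Adj v w := by
        rintro v hv w ⟨hw, hwf⟩
        by_cases hvP : v ∈ P
        · exact (key v hvP (fun h => hv ⟨hvP, h⟩) w hw hwf).symm
        · exact hout v hvP w hw
      refine ⟨fun h => nab (h ⟨hSP haS, hS a haS⟩ ⟨hSP hbS, hS b hbS⟩ hab), ?_, ?_⟩
      · exact fun v hv => ⟨a, ⟨hSP haS, hS a haS⟩, hall v hv a ⟨hSP haS, hS a haS⟩⟩
      · exact fun v hv => Or.inl (hall v hv)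
    · have hall : ∀ v ∉ {v | v ∈ P ∧ φ v ≠ v}, ∀ w ∈ {v | v ∈ P ∧ φ v ≠ v}, G.Adj v w := by
        rintro v hv w ⟨hw, hwf⟩
        by_cases hvP : v ∈ P
        · exact key w hw hwf v hvP (by_contra fun h => hv ⟨hvP, h⟩)
        · exact hout v hvP w hw
      refine ⟨fun h => hnadj n (h ⟨hnP, hn⟩ ⟨hφP n hnP, ?_⟩ (Ne.symm hn)), ?_, ?_⟩
      · exact fun h => hn (φ.injective h)
      · exact fun v hv => ⟨n, ⟨hnP, hn⟩, hall v hv n ⟨hnP, hn⟩⟩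
      · exact fun v hv => Or.inl (hall v hv)
  by_cases hPV : ∃ u, u ∉ P
  · -- no independent triples in `P`
    obtain ⟨u, hu⟩ := hPV
    intro v hv hvn x hx hxf
    by_contra hxv
    refine claw_aux hclaw (hout u hu x hx) (hout u hu v hv) (hout u hu _ (hφP v hv))
      ?_ ?_ (Ne.symm hvn) hxv (fun h => hxv ((hfadj x v hxf).1 h)) (hnadj v)
    · rintro rfl
      exact hvn hxf
    · intro h
      apply hvn
      apply φ.injective
      rw [← h, hxf]
  · push Not at hPV
    have step : ∀ v, φ v ≠ v → ∀ x y, φ x = x → φ y = y → G.Adj x y → G.Adj x v → G.Adj y v := by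
      intro v hvn x y hx hy hxy hxv
      by_contra hyv
      refine claw_aux hclaw hxy hxv ((hfadj x v hx).2 hxv)
        ?_ ?_ (Ne.symm hvn) hyv (fun h => hyv ((hfadj y v hy).1 h)) (hnadj v)
      · rintro rfl
        exact hvn hy
      · intro h
        apply hvn
        apply φ.injective
        rw [← h, hy]
    let R : V → V → Prop := fun x y => φ y = y ∧ G.Adj x y
    let C : Set V := {x | Relation.ReflTransGen R a x}
    have hCfix : ∀ x ∈ C, φ x = x := by
      intro x hx
      rcases Relation.ReflTransGen.cases_tail hx with h | ⟨y, _, h⟩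
      · rw [h]; exact hS a haS
      · exact h.1
    have hCstep : ∀ x ∈ C, ∀ y, φ y = y → G.Adj x y → y ∈ C :=
      fun x hx y hy hxy => Relation.ReflTransGen.tail hx ⟨hy, hxy⟩
    have haC : a ∈ C := Relation.ReflTransGen.refl
    have hSC : ∀ s ∈ S, s ∈ C := by
      intro s hs
      have h := (SimpleGraph.reachable_iff_reflTransGen _ _).1
        (hScon.preconnected ⟨a, haS⟩ ⟨s, hs⟩)
      have h2 := h.lift (p := R) Subtype.val (by
        intro p q hpq
        exact ⟨hS q q.2, hpq⟩)
      exact h2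
    have hCall : ∀ v, φ v ≠ v → ∀ x ∈ C, (G.Adj x v ↔ G.Adj a v) := by
      intro v hvn x hx
      induction hx with
      | refl => rfl
      | @tail y z hy hyz ih =>
        rw [← ih]
        exact ⟨step v hvn z y hyz.1 (hCfix y hy) hyz.2.symm,
          step v hvn y z (hCfix y hy) hyz.1 hyz.2⟩
    have hcover : ∀ w, w ∈ C ∨ (φ w ≠ w ∧ G.Adj a w) := by
      intro w
      have h := (SimpleGraph.reachable_iff_reflTransGen _ _).1 (hconn.preconnected a w)
      induction h with
      | refl => exact Or.inl haC
      | @tail y z _ hyz ih =>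
        by_cases hz : φ z = z
        · left
          rcases ih with hy | ⟨hyn, hay⟩
          · exact hCstep y hy z hz hyz
          · by_contra hzC
            have hby := (hCall y hyn b (hSC b hbS)).2 hay
            have n1 : ∀ x ∈ C, ¬ G.Adj x z := fun x hx h => hzC (hCstep x hx z hz h)
            exact claw_aux hclaw hay.symm hby.symm hyz hab
              (fun h => hzC (h ▸ haC)) (fun h => hzC (h ▸ hSC b hbS))
              nab (n1 a haC) (n1 b (hSC b hbS))
        · right
          refine ⟨hz, ?_⟩
          rcases ih with hy | ⟨hyn, hay⟩
          · exact (hCall z hz y hy).1 hyz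
          · by_contra haz
            have hby := (hCall y hyn b (hSC b hbS)).2 hay
            have hbz : ¬ G.Adj b z := fun h => haz ((hCall z hz b (hSC b hbS)).1 h)
            exact claw_aux hclaw hay.symm hby.symm hyz hab
              (fun h => hz (h ▸ hS a haS)) (fun h => hz (h ▸ hS b hbS))
              nab haz hbz
    intro v _ hvn x _ hxf
    have hxC : x ∈ C := (hcover x).resolve_right fun h => h.1 hxf
    rcases hcover v with h | h
    · exact absurd (hCfix v h) hvn
    · exact (hCall v hvn x hxC).2 h.2
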